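/- Let p ≥ 1 and let x_j = cos((2j−1)π/(2p)) for j = 1, …, p be the Chebyshev nodes of the first kind on [−1,1]. Then for every j = 1, …, p, ∑_{k ≠ j} 1/(x_j − x_k) = x_j / (2 (1 − x_j²)), where the sum runs over k ∈ {1,…,p} with k ≠ j. -/

import Mathlib

noncomputable section

/-- The `j`-th Chebyshev node of the first kind on `[-1,1]`, for `p` nodes
(0-indexed: `x_j = cos((2j+1)π/(2p))`). -/
def chebNode (p : ℕ) (j : Fin p) : ℝ :=
  Real.cos ((2 * (j : ℝ) + 1) * Real.pi / (2 * p))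

open Polynomial

theorem eval_derivative_prod_X_sub_C {ι K : Type*} [DecidableEq ι] [Field K] (s : Finset ι)
    (v : ι → K) (x : K) (hx : ∀ k ∈ s, x ≠ v k) :
    (derivative (∏ k ∈ s, (X - C (v k)))).eval x
      = (∏ k ∈ s, (X - C (v k))).eval x * ∑ k ∈ s, 1 / (x - v k) := by
  rw [derivative_prod_finset, eval_finsetSum, Finset.mul_sum]
  refine Finset.sum_congr rfl fun k hk ↦ ?_
  have hxk : x - v k ≠ 0 := sub_ne_zero.mpr (hx k hk)
  rw [← Finset.mul_prod_erase s _ hk]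
  simp
  field_simp

theorem chebNode_injective (p : ℕ) : Function.Injective (chebNode p) := fun a b hab ↦
  Fin.ext <| (Finset.range p).nodup_map_iff_injOn.mp (Chebyshev.roots_T_real_nodup p)
    (by simp) (by simp) hab

theorem T_eq_C_mul_prod_X_sub_C_chebNode (p : ℕ) :
    Chebyshev.T ℝ p
      = C (Chebyshev.T ℝ p).leadingCoeff * ∏ k, (X - C (chebNode p k)) := by
  have hroots : (Chebyshev.T ℝ p).roots = Finset.univ.val.map (chebNode p) := by
    rw [Chebyshev.roots_T_real, ← Finset.image_val_of_injOn (chebNode_injective p).injOn]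
    congr 1
    ext x
    simp [chebNode, Fin.exists_iff]
  have hcard : (Chebyshev.T ℝ p).roots.card = (Chebyshev.T ℝ p).natDegree := by
    simp [hroots]
  conv_lhs => rw [← C_leadingCoeff_mul_prod_multiset_X_sub_C hcard, hroots, Multiset.map_map]
  rfl

/-- Sum of reciprocals of differences of Chebyshev nodes:
`∑_{k ≠ j} 1/(x_j - x_k) = x_j / (2(1 - x_j²))`. -/
theorem chebNode_sum_inv_sub (p : ℕ) (hp : 1 ≤ p) (j : Fin p) :
    ∑ k ∈ Finset.univ.erase j, 1 / (chebNode p j - chebNode p k)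
      = chebNode p j / (2 * (1 - chebNode p j ^ 2)) := by
  set x := chebNode p j
  set g : ℝ[X] := ∏ k ∈ Finset.univ.erase j, (X - C (chebNode p k)) with hg
  have hne : ∀ k ∈ Finset.univ.erase j, x ≠ chebNode p k := fun k hk h ↦
    Finset.ne_of_mem_erase hk (chebNode_injective p h).symm
  have hg0 : g.eval x ≠ 0 := by
    rw [hg, eval_prod, Finset.prod_ne_zero_iff]
    intro k hk
    simpa [sub_eq_zero] using hne k hk
  have hT := T_eq_C_mul_prod_X_sub_C_chebNode p
  rw [← Finset.mul_prod_erase _ _ (Finset.mem_univ j)] at hT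
  have hc : (Chebyshev.T ℝ p).leadingCoeff ≠ 0 := by simp
  have hode := congr_arg (eval x) (Chebyshev.one_sub_X_sq_mul_derivative_derivative_T_eq_poly_in_T
    (R := ℝ) p)
  generalize (Chebyshev.T ℝ p).leadingCoeff = c at hT hc
  rw [hT] at hode
  simp only [Function.iterate_succ, Function.iterate_zero, Function.comp_apply, id_eq,
    derivative_mul, derivative_add, derivative_sub, derivative_X, derivative_C, derivative_one,
    derivative_zero, eval_mul, eval_add, eval_sub, eval_pow, eval_X, eval_C, eval_one, eval_zero,
    ← hg] at hode
  rw [eval_derivative_prod_X_sub_C _ _ x hne, ← hg] at hode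
  set S := ∑ k ∈ Finset.univ.erase j, 1 / (x - chebNode p k)
  have hS : (1 - x ^ 2) * (2 * S) = x := by
    apply mul_left_cancel₀ (mul_ne_zero hc hg0)
    linear_combination hode
  have hx : 1 - x ^ 2 ≠ 0 := by
    intro h
    have hx0 : x = 0 := by rw [← hS, h, zero_mul]
    simp [hx0] at h
  rw [eq_div_iff (by simpa using hx)]
  linear_combination hS

end
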